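/- Let G be a finite group, k the minimal degree of a nontrivial complex irreducible character of G, and A, B, C subsets of G with |A||B||C| > |G|³/(η²k) for some η > 0. Then for every g ∈ G, the number N of triples (a,b,c) ∈ A×B×C with abc = g satisfies (1−η)·|A||B||C|/|G| < N < (1+η)·|A||B||C|/|G|. -/

import Mathlib

open Finset

/-- The set of complex irreducible characters of `G`. -/
def IrrChar (G : Type) [Group G] : Set (G → ℂ) :=
  {f | ∃ V : FDRep ℂ G, CategoryTheory.Simple V ∧ f = V.character}

open Module in
theorem LinearMap.mul_norm_sq_le_of_le_finrank_eigenspace {E ι : Type*} [NormedAddCommGroup E]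
    [InnerProductSpace ℂ E] [FiniteDimensional ℂ E] [Fintype ι] (T : E →ₗ[ℂ] E)
    (b : OrthonormalBasis ι ℂ E) (k : ℝ)
    (hk : ∀ μ : ℂ, μ ≠ 0 → End.HasEigenvalue (T.adjoint ∘ₗ T) μ →
      k ≤ finrank ℂ (End.eigenspace (T.adjoint ∘ₗ T) μ)) (v : E) :
    k * ‖T v‖ ^ 2 ≤ (∑ i, ‖T (b i)‖ ^ 2) * ‖v‖ ^ 2 := by
  have inner_eq (x : E) : inner ℂ x ((T.adjoint ∘ₗ T) x) = ((‖T x‖ ^ 2 : ℝ) : ℂ) := by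
    simp [LinearMap.adjoint_inner_right]
  set S := T.adjoint ∘ₗ T with hS
  have hsymm : S.IsSymmetric := fun x y => by
    simp [hS, LinearMap.adjoint_inner_right, LinearMap.adjoint_inner_left]
  set l := hsymm.eigenvalues rfl with hl
  set e := hsymm.eigenvectorBasis rfl with he
  have l_eq (i) : l i = ‖T (e i)‖ ^ 2 := by
    have h := inner_eq (e i)
    rw [he, hsymm.apply_eigenvectorBasis, inner_smul_right, ← he, inner_self_eq_norm_sq_to_K] at h
    simp only [OrthonormalBasis.norm_eq_one] at h
    exact Complex.ofReal_injective (by simpa using h)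
  have l_nonneg (i) : 0 ≤ l i := l_eq i ▸ sq_nonneg _
  have trace_eq : ∑ i, l i = ∑ i, ‖T (b i)‖ ^ 2 := by
    have h := (hsymm.trace_eq_sum_eigenvalues rfl).symm.trans (S.trace_eq_sum_inner b)
    simp_rw [inner_eq] at h
    exact Complex.ofReal_injective (by simpa using h)
  have mul_le (i) : k * l i ≤ ∑ j, ‖T (b j)‖ ^ 2 := by
    rcases (l_nonneg i).eq_or_lt with h0 | h0
    · rw [← h0, mul_zero]; positivity
    have hi := hk (l i) (by exact_mod_cast h0.ne') (hsymm.hasEigenvalue_eigenvalues rfl i)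
    rw [← hsymm.card_filter_eigenvalues_eq rfl] at hi
    calc k * l i ≤ _ := mul_le_mul_of_nonneg_right hi h0.le
      _ = ∑ j with ((hsymm.eigenvalues rfl j : ℝ) : ℂ) = (l i : ℂ), l j := by
        rw [Finset.sum_congr rfl (g := fun _ => l i), Finset.sum_const, nsmul_eq_mul]
        · rfl
        · intro j hj
          exact_mod_cast (Finset.mem_filter.1 hj).2
      _ ≤ ∑ j, l j := Finset.sum_le_sum_of_subset_of_nonneg (Finset.filter_subset _ _)
        fun j _ _ => l_nonneg j
      _ = _ := trace_eq
  have norm_T : ‖T v‖ ^ 2 = ∑ i, l i * ‖e.repr v i‖ ^ 2 := by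
    have h := inner_eq v
    rw [← e.repr.inner_map_map, PiLp.inner_apply] at h
    simp_rw [he, hsymm.eigenvectorBasis_apply_self_apply] at h
    rw [← Complex.ofReal_inj, ← h]
    push_cast
    refine Finset.sum_congr rfl fun i _ => ?_
    rw [← he, ← smul_eq_mul, inner_smul_right, inner_self_eq_norm_sq_to_K]
    rfl
  have norm_v : ‖v‖ ^ 2 = ∑ i, ‖e.repr v i‖ ^ 2 := by
    rw [← e.repr.norm_map, EuclideanSpace.norm_sq_eq]
  rw [norm_T, norm_v, Finset.mul_sum, Finset.mul_sum]
  refine Finset.sum_le_sum fun i _ => ?_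
  rw [← mul_assoc]
  exact mul_le_mul_of_nonneg_right (mul_le i) (sq_nonneg _)

namespace Representation

open Module

theorem exists_isIrreducible_subrepresentation {F G V : Type*} [Field F] [Monoid G]
    [AddCommGroup V] [Module F V] [FiniteDimensional F V] [Nontrivial V]
    (ρ : Representation F G V) :
    ∃ σ : Subrepresentation ρ, σ.toRepresentation.IsIrreducible := by
  obtain ⟨σ, hσ, hmin⟩ := (measure
    fun σ : Subrepresentation ρ => finrank F σ.toSubmodule).wf.has_min
      {σ | σ.toSubmodule ≠ ⊥} ⟨⊤, (top_ne_bot : (⊤ : Submodule F V) ≠ ⊥)⟩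
  have hbot_top : (⊥ : Submodule F σ.toSubmodule) ≠ ⊤ := fun h =>
    hσ (Submodule.subsingleton_iff_eq_bot.1 ((Submodule.subsingleton_iff F).1
      (subsingleton_of_bot_eq_top h)))
  refine ⟨σ, { exists_pair_ne := ⟨⊥, ⊤, fun h => hbot_top
    (congrArg Subrepresentation.toSubmodule h)⟩, eq_bot_or_eq_top := fun τ => ?_ }⟩
  by_cases hτ : τ.toSubmodule = ⊥
  · exact Or.inl (Subrepresentation.toSubmodule_injective hτ)
  refine Or.inr (Subrepresentation.toSubmodule_injective ?_)
  let τ' : Subrepresentation ρ :=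
    { toSubmodule := τ.toSubmodule.map σ.toSubmodule.subtype
      apply_mem_toSubmodule := by
        rintro g _ ⟨w, hw, rfl⟩
        exact ⟨_, τ.apply_mem_toSubmodule g hw, rfl⟩ }
  have hle : ¬ finrank F τ'.toSubmodule < finrank F σ.toSubmodule := hmin τ' fun h => hτ
    (Submodule.map_injective_of_injective σ.toSubmodule.injective_subtype
      (h.trans (Submodule.map_bot _).symm))
  rw [not_lt, Submodule.finrank_map_subtype_eq] at hle
  exact Submodule.eq_top_of_finrank_eq (le_antisymm (Submodule.finrank_le _) hle)

theorem IsIrreducible.simple_of {G V : Type} [Group G] [Finite G] [AddCommGroup V] [Module ℂ V]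
    [FiniteDimensional ℂ V] {ρ : Representation ℂ G V} (hρ : ρ.IsIrreducible) :
    CategoryTheory.Simple (FDRep.of ρ) := by
  have := Fintype.ofFinite G
  have hG : (Nat.card G : ℂ) ≠ 0 := NeZero.ne _
  have := invertibleOfNonzero hG
  rw [FDRep.simple_iff_char_is_norm_one]
  have h := char_orthonormal ρ ρ
  rw [if_pos ⟨Equiv.refl ρ⟩, inv_mul_eq_one₀ hG] at h
  exact h.symm

theorem le_finrank_of_invariants_eq_bot {G V : Type} [Group G] [Finite G] [AddCommGroup V]
    [Module ℂ V] [FiniteDimensional ℂ V] [Nontrivial V] (ρ : Representation ℂ G V)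
    (hρ : ρ.invariants = ⊥) {k : ℝ}
    (hk : k ∈ lowerBounds {d : ℝ | ∃ χ ∈ IrrChar G, χ ≠ (fun _ => 1) ∧ χ 1 = (d : ℂ)}) :
    k ≤ finrank ℂ V := by
  have := Fintype.ofFinite G
  have hG : (Nat.card G : ℂ) ≠ 0 := NeZero.ne _
  have := invertibleOfNonzero hG
  obtain ⟨σ, hσ⟩ := ρ.exists_isIrreducible_subrepresentation
  have hinv : finrank ℂ σ.toRepresentation.invariants = 0 := by
    rw [Submodule.finrank_eq_zero, Submodule.eq_bot_iff]
    intro v hv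
    have hv' : (v : V) ∈ ρ.invariants := fun g => congrArg Subtype.val (hv g)
    rw [hρ] at hv'
    exact Subtype.ext hv'
  have hchar : σ.toRepresentation.character ≠ fun _ => 1 := by
    intro h
    have := σ.toRepresentation.card_inv_mul_sum_char_eq_finrank
    rw [hinv, h] at this
    simp at this
  refine (hk ⟨_, ⟨FDRep.of σ.toRepresentation, hσ.simple_of, rfl⟩, hchar, ?_⟩).trans
    (Nat.cast_le.2 (Submodule.finrank_le σ.toSubmodule))
  exact (char_one σ.toRepresentation).trans (Complex.ofReal_natCast _).symm

end Representation

theorem pos_of_mem_irrChar {G : Type} [Group G] [Finite G] {χ : G → ℂ} (hχ : χ ∈ IrrChar G) {d : ℝ}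
    (hd : χ 1 = d) : 0 < d := by
  obtain ⟨V, hV, rfl⟩ := hχ
  rw [FDRep.char_one] at hd
  have hd' : (Module.finrank ℂ V : ℝ) = d := by exact_mod_cast hd
  rw [← hd', Nat.cast_pos, Nat.pos_iff_ne_zero]
  intro h0
  have := Fintype.ofFinite G
  have h := (FDRep.simple_iff_char_is_norm_one V).1 hV
  have hsub : Subsingleton V := Module.finrank_zero_iff.1 h0
  have hchar (g : G) : V.character g = 0 := by
    rw [FDRep.character, Subsingleton.elim (V.ρ g) 0, map_zero]
  simp [hchar, eq_comm] at h

section Convolution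

variable {G : Type} [Group G]

variable (G) in
/-- The representation of `G` by right translations on the Hilbert space of functions on `G`. -/
noncomputable def rightTranslation : Representation ℂ G (EuclideanSpace ℂ G) where
  toFun g :=
    { toFun v := WithLp.toLp 2 fun x => v (x * g)
      map_add' _ _ := rfl
      map_smul' _ _ := rfl }
  map_one' := by ext; simp
  map_mul' g h := LinearMap.ext fun v => PiLp.ext fun x => congrArg v (mul_assoc x g h).symm

theorem rightTranslation_apply (g : G) (v : EuclideanSpace ℂ G) (x : G) :
    rightTranslation G g v x = v (x * g) := rfl

variable [Fintype G]

open Classical in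
/-- Left convolution by `f`, as an operator on the Hilbert space of functions on `G`. -/
noncomputable def leftConvolution (f : G → ℂ) : EuclideanSpace ℂ G →ₗ[ℂ] EuclideanSpace ℂ G :=
  Matrix.toEuclideanLin (Matrix.of fun x y => f (x * y⁻¹))

theorem leftConvolution_apply (f : G → ℂ) (v : EuclideanSpace ℂ G) (x : G) :
    leftConvolution f v x = ∑ y, f (x * y⁻¹) * v y := rfl

theorem adjoint_leftConvolution (f : G → ℂ) :
    (leftConvolution f).adjoint = leftConvolution fun x => star (f x⁻¹) := by
  classical
  rw [leftConvolution, leftConvolution, ← Matrix.toEuclideanLin_conjTranspose_eq_adjoint]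
  congr 1
  ext x y
  simp [Matrix.conjTranspose_apply]

theorem leftConvolution_rightTranslation (f : G → ℂ) (g : G) (v : EuclideanSpace ℂ G) :
    leftConvolution f (rightTranslation G g v) = rightTranslation G g (leftConvolution f v) := by
  ext x
  rw [rightTranslation_apply, leftConvolution_apply, leftConvolution_apply,
    ← Equiv.sum_comp (Equiv.mulRight g) fun y => f (x * g * y⁻¹) * v y]
  simp [rightTranslation_apply, mul_assoc]

theorem leftConvolution_eq_zero_of_mem_invariants {f : G → ℂ} (hf : ∑ x, f x = 0)
    {v : EuclideanSpace ℂ G} (hv : v ∈ (rightTranslation G).invariants) :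
    leftConvolution f v = 0 := by
  have hconst (x : G) : v x = v 1 := by
    conv_rhs => rw [← hv x, rightTranslation_apply, one_mul]
  ext x
  have hsum : ∑ y, f (x * y⁻¹) = ∑ y, f y :=
    Equiv.sum_comp ((Equiv.inv G).trans (Equiv.mulLeft x)) f
  rw [leftConvolution_apply, Finset.sum_congr rfl fun y _ => by rw [hconst y], ← Finset.sum_mul,
    hsum, hf, zero_mul]
  rfl

theorem mul_norm_leftConvolution_sq_le {k : ℝ}
    (hk : k ∈ lowerBounds {d : ℝ | ∃ χ ∈ IrrChar G, χ ≠ (fun _ => 1) ∧ χ 1 = (d : ℂ)})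
    {f : G → ℂ} (hf : ∑ x, f x = 0) (v : EuclideanSpace ℂ G) :
    k * ‖leftConvolution f v‖ ^ 2 ≤ Fintype.card G * (∑ x, ‖f x‖ ^ 2) * ‖v‖ ^ 2 := by
  classical
  have key := (leftConvolution f).mul_norm_sq_le_of_le_finrank_eigenspace
    (EuclideanSpace.basisFun G ℂ) k (fun μ hμ hS => ?_) v
  · convert key using 2
    rw [← nsmul_eq_mul, ← Finset.card_univ, ← Finset.sum_const]
    refine Finset.sum_congr rfl fun y _ => ?_
    rw [EuclideanSpace.norm_sq_eq, ← Equiv.sum_comp (Equiv.mulRight y⁻¹)]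
    simp [leftConvolution_apply]
  rw [adjoint_leftConvolution] at hS ⊢
  set S := leftConvolution (fun x => star (f x⁻¹)) ∘ₗ leftConvolution f with hSdef
  have hcomm (g : G) (w : EuclideanSpace ℂ G) :
      S (rightTranslation G g w) = rightTranslation G g (S w) := by
    simp [hSdef, leftConvolution_rightTranslation]
  let σ : Subrepresentation (rightTranslation G) :=
    { toSubmodule := Module.End.eigenspace S μ
      apply_mem_toSubmodule := fun g w hw => by
        rw [Module.End.mem_eigenspace_iff] at hw ⊢
        rw [hcomm, hw, map_smul] }
  have : Nontrivial σ.toSubmodule := Submodule.nontrivial_iff_ne_bot.2 hS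
  refine σ.toRepresentation.le_finrank_of_invariants_eq_bot ?_ hk
  rw [Submodule.eq_bot_iff]
  intro w hw
  have hw' : (w : EuclideanSpace ℂ G) ∈ (rightTranslation G).invariants :=
    fun g => congrArg Subtype.val (hw g)
  have heig : S w = μ • (w : EuclideanSpace ℂ G) := Module.End.mem_eigenspace_iff.1 w.2
  rw [hSdef, LinearMap.comp_apply, leftConvolution_eq_zero_of_mem_invariants hf hw',
    map_zero] at heig
  exact Subtype.ext ((smul_eq_zero.1 heig.symm).resolve_left hμ)

end Convolution

theorem card_mul_mul_eq_sum_leftConvolution {G : Type} [Group G] [Fintype G] [DecidableEq G]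
    (A B C : Finset G) (t : ℂ) (g : G) :
    (((A ×ˢ B ×ˢ C).filter (fun p => p.1 * p.2.1 * p.2.2 = g)).card : ℂ) - t * (#B * #C) =
      ∑ c ∈ C, leftConvolution (fun x => (if x ∈ A then 1 else 0) - t)
        (WithLp.toLp 2 fun x => if x ∈ B then 1 else 0) (g * c⁻¹) := by
  have hconv (c : G) : leftConvolution (fun x => (if x ∈ A then 1 else 0) - t)
      (WithLp.toLp 2 fun x => if x ∈ B then 1 else 0) (g * c⁻¹) =
        ∑ b ∈ B, ((if g * c⁻¹ * b⁻¹ ∈ A then 1 else 0) - t) := by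
    simp [leftConvolution_apply]
  have hcount (b c : G) : (∑ a ∈ A, if a * b * c = g then (1 : ℂ) else 0) =
      if g * c⁻¹ * b⁻¹ ∈ A then 1 else 0 := by
    simp_rw [← eq_mul_inv_iff_mul_eq]
    rw [Finset.sum_ite_eq']
  simp_rw [hconv, Finset.sum_sub_distrib, ← hcount]
  rw [Finset.card_filter, Finset.sum_product, Nat.cast_sum]
  simp_rw [Finset.sum_product_right]
  push_cast
  rw [Finset.sum_comm]
  simp_rw [Finset.sum_comm (s := A)]
  simp
  ring

theorem mul_sq_card_sub_le {G : Type} [Group G] [Fintype G] [DecidableEq G]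
    (A B C : Finset G) {k : ℝ} (hk0 : 0 ≤ k)
    (hk : k ∈ lowerBounds {d : ℝ | ∃ χ ∈ IrrChar G, χ ≠ (fun _ => 1) ∧ χ 1 = (d : ℂ)}) (g : G) :
    k * ((((A ×ˢ B ×ˢ C).filter (fun p => p.1 * p.2.1 * p.2.2 = g)).card : ℝ)
      - #A * #B * #C / Fintype.card G) ^ 2 ≤ Fintype.card G * (#A * #B * #C) := by
  set f : G → ℂ := fun x => (if x ∈ A then 1 else 0) - #A / Fintype.card G with hf
  set v : EuclideanSpace ℂ G := WithLp.toLp 2 fun x => if x ∈ B then 1 else 0 with hv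
  have hf_sum : ∑ x, f x = 0 := by
    have hG' : (Fintype.card G : ℂ) ≠ 0 := by simp
    simp [hf, Finset.sum_sub_distrib, mul_div_cancel₀ _ hG']
  have hf_norm : ∑ x, ‖f x‖ ^ 2 ≤ #A := by
    have h (x : G) : ‖f x‖ ^ 2 = (if x ∈ A then 1 - 2 * (#A / Fintype.card G : ℝ) else 0)
        + (#A / Fintype.card G : ℝ) ^ 2 := by
      have : f x = (((if x ∈ A then 1 else 0) - #A / Fintype.card G : ℝ) : ℂ) := by
        simp [hf, apply_ite]
      rw [this, Complex.norm_real, Real.norm_eq_abs, sq_abs]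
      split_ifs <;> ring
    simp_rw [h, Finset.sum_add_distrib]
    rw [Finset.sum_ite_mem]
    simp only [Finset.univ_inter, Finset.sum_const, nsmul_eq_mul, Finset.card_univ]
    have : (#A : ℝ) * (1 - 2 * (#A / Fintype.card G)) + Fintype.card G * (#A / Fintype.card G) ^ 2
        = #A - #A ^ 2 / Fintype.card G := by field_simp; ring
    rw [this]
    exact sub_le_self _ (by positivity)
  have hv_norm : ‖v‖ ^ 2 = #B := by
    rw [EuclideanSpace.norm_sq_eq]
    simp [hv, apply_ite]
  have hbound := (mul_norm_leftConvolution_sq_le hk hf_sum v)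
  rw [hv_norm] at hbound
  have hcard : ((((A ×ˢ B ×ˢ C).filter (fun p => p.1 * p.2.1 * p.2.2 = g)).card : ℝ)
      - #A * #B * #C / Fintype.card G) ^ 2 = ‖∑ c ∈ C, leftConvolution f v (g * c⁻¹)‖ ^ 2 := by
    rw [← card_mul_mul_eq_sum_leftConvolution, ← sq_abs, ← Real.norm_eq_abs, ← Complex.norm_real]
    push_cast
    congr 3
    ring
  have hsum : ‖∑ c ∈ C, leftConvolution f v (g * c⁻¹)‖ ^ 2 ≤ #C * ‖leftConvolution f v‖ ^ 2 := by
    calc _ ≤ (∑ c ∈ C, ‖leftConvolution f v (g * c⁻¹)‖) ^ 2 := by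
          gcongr; exact norm_sum_le _ _
      _ ≤ #C * ∑ c ∈ C, ‖leftConvolution f v (g * c⁻¹)‖ ^ 2 := sq_sum_le_card_mul_sum_sq
      _ ≤ #C * ∑ c, ‖leftConvolution f v (g * c⁻¹)‖ ^ 2 := by
          gcongr
          exact Finset.subset_univ C
      _ = _ := by
          rw [EuclideanSpace.norm_sq_eq]
          congr 1
          exact Equiv.sum_comp ((Equiv.inv G).trans (Equiv.mulLeft g))
            fun x => ‖leftConvolution f v x‖ ^ 2
  rw [hcard]
  calc _ ≤ k * (#C * ‖leftConvolution f v‖ ^ 2) := by gcongr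
    _ = #C * (k * ‖leftConvolution f v‖ ^ 2) := by ring
    _ ≤ #C * (Fintype.card G * #A * #B) := by
      refine mul_le_mul_of_nonneg_left (hbound.trans ?_) (Nat.cast_nonneg _)
      gcongr
    _ = _ := by ring

theorem stmt7 {G : Type} [Group G] [Fintype G] [DecidableEq G]
    (A B C : Finset G) (hA : A.Nonempty) (hB : B.Nonempty) (hC : C.Nonempty)
    (k : ℝ)
    (hk : IsLeast {d : ℝ | ∃ χ ∈ IrrChar G, χ ≠ (fun _ => 1) ∧ χ 1 = (d : ℂ)} k)
    (η : ℝ) (hη : 0 < η)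
    (hABC : (A.card : ℝ) * (B.card : ℝ) * (C.card : ℝ)
        > (Fintype.card G : ℝ) ^ 3 / (η ^ 2 * k)) :
    ∀ g : G,
      (1 - η) * ((A.card : ℝ) * (B.card : ℝ) * (C.card : ℝ) / (Fintype.card G : ℝ))
          < (((A ×ˢ B ×ˢ C).filter (fun p => p.1 * p.2.1 * p.2.2 = g)).card : ℝ) ∧
      (((A ×ˢ B ×ˢ C).filter (fun p => p.1 * p.2.1 * p.2.2 = g)).card : ℝ)
          < (1 + η) * ((A.card : ℝ) * (B.card : ℝ) * (C.card : ℝ) / (Fintype.card G : ℝ)) := by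
  intro g
  obtain ⟨⟨χ, hχ, -, hχ1⟩, hlb⟩ := hk
  have hk0 : 0 < k := pos_of_mem_irrChar hχ hχ1
  have hG : (0 : ℝ) < Fintype.card G := by exact_mod_cast Fintype.card_pos
  have hbound := mul_sq_card_sub_le A B C hk0.le hlb g
  set N : ℝ := (((A ×ˢ B ×ˢ C).filter (fun p => p.1 * p.2.1 * p.2.2 = g)).card : ℝ)
  set P : ℝ := #A * #B * #C with hP
  set n : ℝ := (Fintype.card G : ℝ)
  have hP0 : 0 < P := by
    have := hA.card_pos
    have := hB.card_pos
    have := hC.card_pos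
    positivity
  have habs : |N - P / n| < η * (P / n) := by
    refine abs_lt_of_sq_lt_sq (lt_of_mul_lt_mul_left ?_ hk0.le) (by positivity)
    refine hbound.trans_lt ?_
    rw [gt_iff_lt, div_lt_iff₀ (by positivity)] at hABC
    have hrw : k * (η * (P / n)) ^ 2 = P * (P * (η ^ 2 * k)) / n ^ 2 := by ring
    rw [hrw, lt_div_iff₀ (by positivity)]
    calc n * P * n ^ 2 = P * n ^ 3 := by ring
      _ < _ := by gcongr
  rw [abs_lt] at habs
  constructor <;> linarith [habs.1, habs.2]
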